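/- For continuous relations ζ : (X,c) ⇸ (Y,d) and η : (Y,d) ⇸ (Z,e) between closure spaces, c(ζ*(d(η*(C)))) = c(ζ*(η*(C))) = c((η ∘ ζ)*(C)) for all C ⊆ Z, where η ∘ ζ = {(x,z) | ∃ y ∈ Y, (x,y) ∈ ζ and (y,z) ∈ η}. -/

import Mathlib

/-- The inverse-image operator `ζ*` of a relation `ζ ⊆ X × Y`. -/
def relStar {X Y : Type*} (ζ : Set (X × Y)) (B : Set Y) : Set X :=
  {x : X | ∃ y ∈ B, (x, y) ∈ ζ}

/-- The composite of relations `ζ ⊆ X × Y` and `η ⊆ Y × Z`. -/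
def relComp {X Y Z : Type*} (η : Set (Y × Z)) (ζ : Set (X × Y)) : Set (X × Z) :=
  {p : X × Z | ∃ y : Y, (p.1, y) ∈ ζ ∧ (y, p.2) ∈ η}

theorem relStar_mono {X Y : Type*} (ζ : Set (X × Y)) {A B : Set Y} (h : A ⊆ B) :
    relStar ζ A ⊆ relStar ζ B :=
  fun _ ⟨y, hy, hxy⟩ => ⟨y, h hy, hxy⟩

theorem relStar_relComp {X Y Z : Type*} (η : Set (Y × Z)) (ζ : Set (X × Y)) (C : Set Z) :
    relStar (relComp η ζ) C = relStar ζ (relStar η C) := by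
  ext x
  constructor
  · rintro ⟨z, hz, y, hxy, hyz⟩
    exact ⟨y, ⟨z, hz, hyz⟩, hxy⟩
  · rintro ⟨y, ⟨z, hz, hyz⟩, hxy⟩
    exact ⟨z, hz, y, hxy, hyz⟩

/-- The composition law for continuous relations between closure
spaces: `c (ζ* (d (η* C))) = c (ζ* (η* C)) = c ((η ∘ ζ)* C)`. -/
theorem comp_continuous_relation_closure {X Y Z : Type*}
    (c : Set X → Set X) (d : Set Y → Set Y) (e : Set Z → Set Z)
    (hcmono : ∀ A B : Set X, A ⊆ B → c A ⊆ c B)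
    (hcext : ∀ A : Set X, A ⊆ c A)
    (hcidem : ∀ A : Set X, c (c A) = c A)
    (hdmono : ∀ A B : Set Y, A ⊆ B → d A ⊆ d B)
    (hdext : ∀ A : Set Y, A ⊆ d A)
    (hdidem : ∀ A : Set Y, d (d A) = d A)
    (hemono : ∀ A B : Set Z, A ⊆ B → e A ⊆ e B)
    (heext : ∀ A : Set Z, A ⊆ e A)
    (heidem : ∀ A : Set Z, e (e A) = e A)
    (ζ : Set (X × Y)) (η : Set (Y × Z))
    (hζ : ∀ B : Set Y, relStar ζ (d B) ⊆ c (relStar ζ B))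
    (hη : ∀ C : Set Z, relStar η (e C) ⊆ d (relStar η C)) :
    ∀ C : Set Z,
      c (relStar ζ (d (relStar η C))) = c (relStar ζ (relStar η C)) ∧
      c (relStar ζ (relStar η C)) = c (relStar (relComp η ζ) C) := by
  intro C
  refine ⟨Set.Subset.antisymm ?_ ?_, ?_⟩
  · exact (hcmono _ _ (hζ _)).trans (hcidem _).subset
  · exact hcmono _ _ (relStar_mono ζ (hdext _))
  · rw [relStar_relComp]
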